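/- arXiv:2209.04733 — 2 statements merged into one kernel-verified Lean document; each statement's English description precedes it below -/
import Mathlib

section
/- Let r > 0 and let x ∈ [0,1]^d satisfy ‖x‖₁ = Σ_{i=1}^d x_i < 1, and let η ∼ NegMultinomial(r, x). Then for all p₁,…,p_d ∈ ℕ₀, the mixed non-central moment satisfies E[∏_{i=1}^d η_i^{p_i}] = Σ_{k₁=0}^{p₁} ⋯ Σ_{k_d=0}^{p_d} (r − 1 + ‖k‖₁)^{(‖k‖₁)} · ∏_{i=1}^d S(p_i, k_i) y_i^{k_i}, where S(p, k) denotes the Stirling number of the second kind and ‖k‖₁ = Σ_{i=1}^d k_i. -/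
open scoped BigOperators

/-- The `k`-th order falling factorial `m^{(k)} = m(m-1)⋯(m-k+1)` of a real number `m`. -/
noncomputable def fallingFactorial (m : ℝ) (k : ℕ) : ℝ :=
  ∏ i ∈ Finset.range k, (m - (i : ℝ))

/-- The probability mass function of the negative multinomial distribution
`NegMultinomial(r, x)` on `ℕ₀^d`. -/
noncomputable def negMultinomialPMF (d : ℕ) (r : ℝ) (x : Fin d → ℝ) (k : Fin d → ℕ) : ℝ :=
  Real.Gamma (r + ∑ i, (k i : ℝ)) / (Real.Gamma r * ∏ i, Real.Gamma ((k i : ℝ) + 1)) *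
    (1 - ∑ i, x i) ^ r * ∏ i, (x i) ^ (k i)

/-- The Stirling number of the second kind: the number of ways to partition a set of
`n` objects into `k` non-empty subsets. -/
def stirling2 : ℕ → ℕ → ℕ
  | 0, 0 => 1
  | 0, _ + 1 => 0
  | _ + 1, 0 => 0
  | n + 1, k + 1 => (k + 1) * stirling2 n (k + 1) + stirling2 n k

theorem Gamma_add_natCast_eq (s : ℝ) (hs : 0 < s) (n : ℕ) :
    Real.Gamma (s + n) = Real.Gamma s * (ascPochhammer ℝ n).eval s := by
  induction n with
  | zero => simp
  | succ n ih =>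
    rw [ascPochhammer_succ_eval, Nat.cast_succ, ← add_assoc, Real.Gamma_add_one (by positivity), ih]
    ring

theorem fallingFactorial_eq_ascPochhammer_eval (s : ℝ) (n : ℕ) :
    fallingFactorial (s - 1 + n) n = (ascPochhammer ℝ n).eval s := by
  induction n with
  | zero => simp [fallingFactorial]
  | succ n ih =>
    rw [ascPochhammer_succ_eval, ← ih, fallingFactorial, Finset.prod_range_succ', fallingFactorial]
    congr 1
    · refine Finset.prod_congr rfl fun i _ => ?_
      push_cast
      ring
    · push_cast
      ring

theorem ringChoose_eq_ascPochhammer_eval (s : ℝ) (n : ℕ) :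
    Ring.choose (s + n - 1) n = (ascPochhammer ℝ n).eval s / (n.factorial : ℝ) := by
  rw [Ring.choose_eq_smul, Polynomial.descPochhammer_smeval_eq_ascPochhammer,
    Polynomial.ascPochhammer_smeval_cast, Polynomial.ascPochhammer_smeval_eq_eval,
    smul_eq_mul, div_eq_inv_mul]
  congr 2
  ring

theorem hasSum_ascPochhammer_mul_pow (s t : ℝ) (ht0 : 0 ≤ t) (ht1 : t < 1) :
    HasSum (fun n : ℕ => (ascPochhammer ℝ n).eval s / (n.factorial : ℝ) * t ^ n)
      ((1 - t) ^ s)⁻¹ := by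
  have h := (Real.one_div_one_sub_rpow_hasFPowerSeriesOnBall_zero s).hasSum (y := t)
    (by simpa [enorm_eq_nnnorm, ← NNReal.coe_lt_coe, abs_of_nonneg ht0] using ht1)
  simpa [FormalMultilinearSeries.ofScalars_apply_eq, ringChoose_eq_ascPochhammer_eval, mul_comm]
    using h

theorem sum_prod_pow_div_factorial {ι : Type*} [Fintype ι] [DecidableEq ι] (x : ι → ℝ) (n : ℕ) :
    ∑ m ∈ Finset.piAntidiag Finset.univ n, ∏ i, x i ^ m i / ((m i).factorial : ℝ)
      = (∑ i, x i) ^ n / (n.factorial : ℝ) := by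
  rw [Finset.sum_pow_eq_sum_piAntidiag, Finset.sum_div]
  refine Finset.sum_congr rfl fun m hm => ?_
  have hn : ∑ i, m i = n := (Finset.mem_piAntidiag.1 hm).1
  have h := Nat.multinomial_spec Finset.univ m
  rw [hn] at h
  rw [Finset.prod_div_distrib, ← h]
  have h1 : (Nat.multinomial Finset.univ m : ℝ) ≠ 0 := by
    exact_mod_cast fun h0 => Nat.factorial_ne_zero n (by rw [← h, h0, mul_zero])
  have h2 : (∏ i, ((m i).factorial : ℝ)) ≠ 0 :=
    Finset.prod_ne_zero_iff.2 fun i _ => by exact_mod_cast Nat.factorial_ne_zero _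
  push_cast
  field_simp

/-- The negative multinomial series. -/
theorem hasSum_ascPochhammer_mul_prod_pow {ι : Type*} [Fintype ι] (s : ℝ) (hs : 0 < s) (x : ι → ℝ)
    (hx : ∀ i, 0 ≤ x i) (hx1 : ∑ i, x i < 1) :
    HasSum (fun m : ι → ℕ => (ascPochhammer ℝ (∑ i, m i)).eval s *
      ∏ i, x i ^ m i / ((m i).factorial : ℝ)) ((1 - ∑ i, x i) ^ s)⁻¹ := by
  classical
  have hsum := hasSum_ascPochhammer_mul_pow s _ (Finset.sum_nonneg fun i _ => hx i) hx1
  rw [← (Equiv.sigmaFiberEquiv fun m : ι → ℕ => ∑ i, m i).hasSum_iff]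
  have hfib : ∀ n : ℕ, HasSum (fun m : {m : ι → ℕ // ∑ i, m i = n} =>
      (ascPochhammer ℝ (∑ i, m.1 i)).eval s * ∏ i, x i ^ m.1 i / ((m.1 i).factorial : ℝ))
      ((ascPochhammer ℝ n).eval s / (n.factorial : ℝ) * (∑ i, x i) ^ n) := by
    intro n
    have h := (Finset.hasSum (Finset.piAntidiag (Finset.univ : Finset ι) n)
      fun m => (ascPochhammer ℝ n).eval s * ∏ i, x i ^ m i / ((m i).factorial : ℝ))
    rw [← Finset.mul_sum, sum_prod_pow_div_factorial, ← mul_div_assoc, ← div_mul_eq_mul_div] at h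
    let e : {m : ι → ℕ // ∑ i, m i = n} ≃ (Finset.piAntidiag (Finset.univ : Finset ι) n) :=
      Equiv.subtypeEquivRight fun m => by simp
    convert! e.hasSum_iff.2 h using 2 with m
    simp [e, m.2]
  have hnonneg : ∀ m : ι → ℕ, 0 ≤ (ascPochhammer ℝ (∑ i, m i)).eval s *
      ∏ i, x i ^ m i / ((m i).factorial : ℝ) := fun m =>
    mul_nonneg (ascPochhammer_pos _ _ hs).le
      (Finset.prod_nonneg fun i _ => div_nonneg (pow_nonneg (hx i) _) (Nat.cast_nonneg _))
  refine HasSum.sigma_of_hasSum hsum hfib ?_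
  refine (summable_sigma_of_nonneg fun m => hnonneg _).2 ⟨fun n => (hfib n).summable, ?_⟩
  convert hsum.summable using 2 with n
  exact (hfib n).tsum_eq

theorem pow_eq_sum_stirling2_mul_descFactorial (n p : ℕ) :
    n ^ p = ∑ k ∈ Finset.range (p + 1), stirling2 p k * n.descFactorial k := by
  have hzero : ∀ p k, p < k → stirling2 p k = 0 := by
    intro p
    induction p with
    | zero => rintro (_ | k) h <;> simp_all [stirling2]
    | succ p ih =>
      rintro (_ | k) h
      · omega
      · simp [stirling2, ih k (by omega), ih (k + 1) (by omega)]
  have hstep : ∀ k, n * n.descFactorial k = n.descFactorial (k + 1) + k * n.descFactorial k := by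
    intro k
    rw [Nat.descFactorial_succ, ← add_mul]
    rcases le_or_gt k n with h | h
    · rw [Nat.sub_add_cancel h]
    · simp [Nat.descFactorial_of_lt h]
  induction p with
  | zero => simp [stirling2]
  | succ p ih =>
    have hshift : ∑ k ∈ Finset.range (p + 1), stirling2 p k * (k * n.descFactorial k)
        = ∑ k ∈ Finset.range (p + 1),
          stirling2 p (k + 1) * ((k + 1) * n.descFactorial (k + 1)) := by
      have h1 := Finset.sum_range_succ (fun k => stirling2 p k * (k * n.descFactorial k)) (p + 1)
      rw [Finset.sum_range_succ'] at h1
      simpa [hzero p (p + 1) (by omega)] using h1.symm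
    rw [pow_succ', ih, Finset.mul_sum, Finset.sum_range_succ' _ (p + 1)]
    simp only [mul_left_comm n, hstep, mul_add, Finset.sum_add_distrib, hshift]
    rw [← Finset.sum_add_distrib]
    simp only [stirling2, zero_mul, add_zero]
    exact Finset.sum_congr rfl fun k _ => by ring

theorem negMultinomialPMF_eq (d : ℕ) (r : ℝ) (hr : 0 < r) (x : Fin d → ℝ) (m : Fin d → ℕ) :
    negMultinomialPMF d r x m = (ascPochhammer ℝ (∑ i, m i)).eval r * (1 - ∑ i, x i) ^ r *
      ∏ i, x i ^ m i / ((m i).factorial : ℝ) := by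
  have h := Gamma_add_natCast_eq r hr (∑ i, m i)
  push_cast at h
  simp only [negMultinomialPMF, h, Real.Gamma_nat_eq_factorial, Finset.prod_div_distrib]
  rw [mul_div_mul_left _ _ (Real.Gamma_pos_of_pos hr).ne']
  ring

theorem ascPochhammer_add_eval (r : ℝ) (a b : ℕ) :
    (ascPochhammer ℝ (a + b)).eval r
      = (ascPochhammer ℝ a).eval r * (ascPochhammer ℝ b).eval (r + a) := by
  rw [← ascPochhammer_mul]
  simp

/-- The mixed factorial moments of the negative multinomial distribution. -/
theorem hasSum_negMultinomialPMF_mul_descFactorial (d : ℕ) (r : ℝ) (hr : 0 < r) (x : Fin d → ℝ)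
    (hx : ∀ i, 0 ≤ x i) (hx1 : ∑ i, x i < 1) (k : Fin d → ℕ) :
    HasSum (fun m : Fin d → ℕ => negMultinomialPMF d r x m *
        ∏ i, ((m i).descFactorial (k i) : ℝ))
      ((ascPochhammer ℝ (∑ i, k i)).eval r * ∏ i, (x i / (1 - ∑ j, x j)) ^ k i) := by
  have hpos : 0 < 1 - ∑ i, x i := sub_pos.2 hx1
  rw [← (add_right_injective k).hasSum_iff]
  · have h := (hasSum_ascPochhammer_mul_prod_pow (r + (∑ i, k i : ℕ)) (by positivity) x hx
      hx1).mul_left ((ascPochhammer ℝ (∑ i, k i)).eval r * (1 - ∑ i, x i) ^ r * ∏ i, x i ^ k i)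
    convert! h using 1
    · ext m
      have hprod : (∏ i, x i ^ (k i + m i) / ((k i + m i).factorial : ℝ)) *
          ∏ i, ((k i + m i).descFactorial (k i) : ℝ)
          = (∏ i, x i ^ k i) * ∏ i, x i ^ m i / ((m i).factorial : ℝ) := by
        simp only [← Finset.prod_mul_distrib]
        refine Finset.prod_congr rfl fun i _ => ?_
        have hf := Nat.factorial_mul_descFactorial (Nat.le_add_right (k i) (m i))
        rw [Nat.add_sub_cancel_left] at hf
        rw [← hf, pow_add]
        have h1 : ((k i + m i).descFactorial (k i) : ℝ) ≠ 0 := by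
          exact_mod_cast fun h0 => Nat.factorial_ne_zero (k i + m i) (by rw [← hf, h0, mul_zero])
        have h2 : ((m i).factorial : ℝ) ≠ 0 := by exact_mod_cast Nat.factorial_ne_zero _
        push_cast
        field_simp
      simp only [Function.comp_apply, negMultinomialPMF_eq d r hr, Pi.add_apply]
      rw [mul_assoc, hprod, Finset.sum_add_distrib, ascPochhammer_add_eval]
      ring
    · rw [Real.rpow_add hpos, Real.rpow_natCast]
      simp only [div_pow, Finset.prod_div_distrib, Finset.prod_pow_eq_pow_sum]
      have := (Real.rpow_pos_of_pos hpos r).ne'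
      field_simp
  · intro m hm
    have : ∃ i, m i < k i := by
      by_contra! h
      exact hm ⟨m - k, by ext i; simp [h i]⟩
    obtain ⟨i, hi⟩ := this
    rw [Finset.prod_eq_zero (Finset.mem_univ i), mul_zero]
    simp [Nat.descFactorial_of_lt hi]

theorem negMultinomial_nonCentralMoments (d : ℕ) (r : ℝ) (hr : 0 < r) (x : Fin d → ℝ)
    (hx : ∀ i, x i ∈ Set.Icc (0 : ℝ) 1) (hx1 : ∑ i, x i < 1)
    (y : Fin d → ℝ) (hy : ∀ i, y i = x i / (1 - ∑ j, x j))
    (p : Fin d → ℕ) :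
    (∑' η : Fin d → ℕ, negMultinomialPMF d r x η * (∏ i, (η i : ℝ) ^ (p i)))
      = ∑ k ∈ Fintype.piFinset (fun i => Finset.range (p i + 1)),
          fallingFactorial (r - 1 + ∑ i, (k i : ℝ)) (∑ i, k i) *
            ∏ i, (stirling2 (p i) (k i) : ℝ) * (y i) ^ (k i) := by
  have hpow : ∀ η : Fin d → ℕ, negMultinomialPMF d r x η * ∏ i, (η i : ℝ) ^ p i
      = ∑ k ∈ Fintype.piFinset (fun i => Finset.range (p i + 1)),
        (∏ i, (stirling2 (p i) (k i) : ℝ)) * (negMultinomialPMF d r x η *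
          ∏ i, ((η i).descFactorial (k i) : ℝ)) := by
    intro η
    have h : ∀ i, (η i : ℝ) ^ p i = ∑ k ∈ Finset.range (p i + 1),
        (stirling2 (p i) k : ℝ) * ((η i).descFactorial k : ℝ) := fun i => by
      exact_mod_cast pow_eq_sum_stirling2_mul_descFactorial (η i) (p i)
    simp only [h, Finset.prod_univ_sum, Finset.mul_sum, Finset.prod_mul_distrib]
    exact Finset.sum_congr rfl fun k _ => by ring
  have hmain := hasSum_sum (s := Fintype.piFinset (fun i => Finset.range (p i + 1)))
    fun k _ => (hasSum_negMultinomialPMF_mul_descFactorial d r hr x (fun i => (hx i).1) hx1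
      k).mul_left (∏ i, (stirling2 (p i) (k i) : ℝ))
  simp only [hpow]
  rw [hmain.tsum_eq]
  refine Finset.sum_congr rfl fun k _ => ?_
  rw [← Nat.cast_sum, fallingFactorial_eq_ascPochhammer_eval, Finset.prod_mul_distrib]
  simp only [hy]
  ring
end

section
/- Let r > 0 and let x ∈ [0,1]^d satisfy ‖x‖₁ = Σ_{i=1}^d x_i < 1, and let η ∼ NegMultinomial(r, x). Then for all p₁,…,p_d ∈ ℕ₀, the mixed central moment satisfies E[∏_{i=1}^d (η_i − E[η_i])^{p_i}] = Σ_{ℓ₁=0}^{p₁} ⋯ Σ_{ℓ_d=0}^{p_d} Σ_{k₁=0}^{ℓ₁} ⋯ Σ_{k_d=0}^{ℓ_d} (r − 1 + ‖k‖₁)^{(‖k‖₁)} · (−r)^{Σ_{i=1}^d (p_i − ℓ_i)} · ∏_{i=1}^d C(p_i, ℓ_i) S(ℓ_i, k_i) y_i^{p_i − ℓ_i + k_i}, where C(p, ℓ) is the binomial coefficient, S(ℓ, k) the Stirling number of the second kind, and ‖k‖₁ = Σ_{i=1}^d k_i. -/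
open scoped BigOperators

theorem Gamma_add_natCast_eq_mul_ascPochhammer {r : ℝ} (hr : 0 < r) (n : ℕ) :
    Real.Gamma (r + n) = Real.Gamma r * (ascPochhammer ℝ n).eval r := by
  induction n with
  | zero => simp
  | succ n ih =>
    rw [Nat.cast_succ, ← add_assoc, Real.Gamma_add_one (by positivity), ih, ascPochhammer_succ_eval]
    ring

theorem fallingFactorial_eq_ascPochhammer (r : ℝ) (n : ℕ) :
    fallingFactorial (r - 1 + n) n = (ascPochhammer ℝ n).eval r := by
  induction n with
  | zero => simp [fallingFactorial]
  | succ n ih =>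
    have h : fallingFactorial (r - 1 + (n + 1 : ℕ)) (n + 1)
        = fallingFactorial (r - 1 + n) n * (r + n) := by
      rw [fallingFactorial, fallingFactorial, Finset.prod_range_succ']
      congr 1
      · refine Finset.prod_congr rfl fun i _ => ?_
        push_cast
        ring
      · push_cast
        ring
    rw [h, ih, ascPochhammer_succ_eval]

theorem hasSum_Gamma_add_div_mul_pow {r s : ℝ} (hr : 0 < r) (hs : |s| < 1) :
    HasSum (fun n : ℕ => Real.Gamma (r + n) / (Real.Gamma r * n.factorial) * s ^ n)
      ((1 - s) ^ (-r)) := by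
  have h := (Real.one_div_one_sub_rpow_hasFPowerSeriesOnBall_zero r).hasSum (y := s)
    (by simpa [enorm_eq_nnnorm, ← NNReal.coe_lt_coe] using hs)
  have hpos : 0 ≤ 1 - s := by linarith [le_abs_self s]
  have hΓ := Real.Gamma_pos_of_pos hr
  rw [zero_add, one_div, ← Real.rpow_neg hpos] at h
  convert! h using 2 with n
  have hfac := Ring.factorial_nsmul_multichoose_eq_ascPochhammer r n
  rw [Polynomial.ascPochhammer_smeval_eq_eval, Ring.multichoose_eq, nsmul_eq_mul] at hfac
  have hn : (n.factorial : ℝ) ≠ 0 := by positivity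
  simp only [FormalMultilinearSeries.ofScalars_apply_eq, smul_eq_mul]
  rw [Gamma_add_natCast_eq_mul_ascPochhammer hr, ← hfac]
  field_simp

theorem cast_multinomial_eq_div {ι : Type*} (s : Finset ι) (k : ι → ℕ) :
    (Nat.multinomial s k : ℝ) = (∑ i ∈ s, k i).factorial / ∏ i ∈ s, ((k i).factorial : ℝ) := by
  rw [eq_div_iff (by positivity), mul_comm]
  exact_mod_cast Nat.multinomial_spec s k

theorem negMultinomialPMF_eq_multinomial (d : ℕ) (r : ℝ) (x : Fin d → ℝ) (k : Fin d → ℕ) :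
    negMultinomialPMF d r x k = (1 - ∑ i, x i) ^ r *
      (Real.Gamma (r + (∑ i, k i : ℕ)) / (Real.Gamma r * (∑ i, k i).factorial) *
        (Nat.multinomial Finset.univ k * ∏ i, x i ^ k i)) := by
  have hn : ((∑ i, k i).factorial : ℝ) ≠ 0 := by positivity
  simp only [negMultinomialPMF, cast_multinomial_eq_div, Real.Gamma_nat_eq_factorial]
  push_cast
  field_simp

theorem hasSum_negMultinomialPMF {d : ℕ} {r : ℝ} (hr : 0 < r) {x : Fin d → ℝ}
    (hx : ∀ i, 0 ≤ x i) (hx1 : ∑ i, x i < 1) :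
    HasSum (negMultinomialPMF d r x) 1 := by
  have hs : |∑ i, x i| < 1 := by
    rwa [abs_of_nonneg (Finset.sum_nonneg fun i _ => hx i)]
  have hpos : 0 < 1 - ∑ i, x i := by linarith
  have htotal := (hasSum_Gamma_add_div_mul_pow hr hs).mul_left ((1 - ∑ i, x i) ^ r)
  rw [← Real.rpow_add hpos, add_neg_cancel, Real.rpow_zero] at htotal
  rw [← (Equiv.sigmaFiberEquiv fun k : Fin d → ℕ => ∑ i, k i).hasSum_iff]
  have hfiber (n : ℕ) : HasSum
      (fun k : {k : Fin d → ℕ // ∑ i, k i = n} => negMultinomialPMF d r x k)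
      ((1 - ∑ i, x i) ^ r *
        (Real.Gamma (r + n) / (Real.Gamma r * n.factorial) * (∑ i, x i) ^ n)) := by
    have hsub := (Finset.piAntidiag Finset.univ n).hasSum (negMultinomialPMF d r x)
    have hset : ((Finset.piAntidiag Finset.univ n : Finset (Fin d → ℕ)) : Set (Fin d → ℕ)) =
        {k | ∑ i, k i = n} := by
      ext k
      simp
    rw [hset] at hsub
    convert! hsub using 1
    rw [Finset.sum_pow_eq_sum_piAntidiag, Finset.mul_sum, Finset.mul_sum]
    refine Finset.sum_congr rfl fun k hk => ?_
    obtain rfl : ∑ i, k i = n := by simpa using hk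
    rw [negMultinomialPMF_eq_multinomial]
  refine HasSum.sigma_of_hasSum htotal hfiber ?_
  refine (summable_sigma_of_nonneg fun k => ?_).2
    ⟨fun n => (hfiber n).summable, htotal.summable.congr fun n => (hfiber n).tsum_eq.symm⟩
  rw [Function.comp_apply, negMultinomialPMF_eq_multinomial]
  have hΓ := Real.Gamma_pos_of_pos hr
  have hprod (k : Fin d → ℕ) : 0 ≤ ∏ i, x i ^ k i :=
    Finset.prod_nonneg fun i _ => pow_nonneg (hx i) _
  have hΓ' (n : ℕ) : 0 < Real.Gamma (r + n) := Real.Gamma_pos_of_pos (by positivity)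
  have := hprod (Equiv.sigmaFiberEquiv (fun k : Fin d → ℕ => ∑ i, k i) k)
  have := hΓ' (∑ i, Equiv.sigmaFiberEquiv (fun k : Fin d → ℕ => ∑ i, k i) k i)
  positivity

theorem negMultinomialPMF_add_mul_prod_descFactorial {d : ℕ} {r : ℝ} (hr : 0 < r)
    {x : Fin d → ℝ} (hx1 : ∑ i, x i < 1) (k n : Fin d → ℕ) :
    negMultinomialPMF d r x (k + n) * ∏ i, (((k + n) i).descFactorial (n i) : ℝ) =
      (ascPochhammer ℝ (∑ i, n i)).eval r * (∏ i, (x i / (1 - ∑ j, x j)) ^ n i) *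
        negMultinomialPMF d (r + (∑ i, n i : ℕ)) x k := by
  have hpos : 0 < 1 - ∑ i, x i := by linarith
  have hΓ := Real.Gamma_pos_of_pos hr
  have hfac (i : Fin d) : ((k i + n i).factorial : ℝ) =
      (k i).factorial * ((k i + n i).descFactorial (n i) : ℝ) := by
    have h := Nat.factorial_mul_descFactorial (Nat.le_add_left (n i) (k i))
    rw [Nat.add_sub_cancel] at h
    exact_mod_cast h.symm
  have hdesc (i : Fin d) : ((k i + n i).descFactorial (n i) : ℝ) ≠ 0 := by
    have := Nat.descFactorial_pos.2 (Nat.le_add_left (n i) (k i))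
    positivity
  have hprod : ∏ i, ((k i + n i).descFactorial (n i) : ℝ) ≠ 0 :=
    Finset.prod_ne_zero_iff.2 fun i _ => hdesc i
  have hasc : (ascPochhammer ℝ (∑ i, n i)).eval r ≠ 0 := (ascPochhammer_pos _ r hr).ne'
  have harg : r + ∑ i, ((k i + n i : ℕ) : ℝ) = r + (∑ i, n i : ℕ) + ∑ i, (k i : ℝ) := by
    push_cast
    rw [Finset.sum_add_distrib]
    ring
  simp only [negMultinomialPMF, Pi.add_apply, harg, Real.Gamma_nat_eq_factorial, hfac,
    Finset.prod_mul_distrib, pow_add, div_pow, Finset.prod_div_distrib, Finset.prod_pow_eq_pow_sum,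
    Gamma_add_natCast_eq_mul_ascPochhammer hr, Real.rpow_add_natCast hpos.ne']
  field_simp

theorem hasSum_negMultinomialPMF_mul_prod_descFactorial {d : ℕ} {r : ℝ} (hr : 0 < r)
    {x : Fin d → ℝ} (hx : ∀ i, 0 ≤ x i) (hx1 : ∑ i, x i < 1) (n : Fin d → ℕ) :
    HasSum (fun η : Fin d → ℕ =>
        negMultinomialPMF d r x η * ∏ i, ((η i).descFactorial (n i) : ℝ))
      ((ascPochhammer ℝ (∑ i, n i)).eval r * ∏ i, (x i / (1 - ∑ j, x j)) ^ n i) := by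
  rw [← (add_left_injective n).hasSum_iff]
  · have h := (hasSum_negMultinomialPMF (r := r + (∑ i, n i : ℕ)) (by positivity) hx hx1).mul_left
      ((ascPochhammer ℝ (∑ i, n i)).eval r * ∏ i, (x i / (1 - ∑ j, x j)) ^ n i)
    rw [mul_one] at h
    exact h.congr_fun fun k => negMultinomialPMF_add_mul_prod_descFactorial hr hx1 k n
  · intro η hη
    obtain ⟨i, hi⟩ : ∃ i, η i < n i := by
      by_contra! h
      exact hη ⟨η - n, funext fun i => Nat.sub_add_cancel (h i)⟩
    rw [Finset.prod_eq_zero (Finset.mem_univ i), mul_zero]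
    simpa using Nat.descFactorial_eq_zero_iff_lt.2 hi

theorem stirling2_eq_stirlingSecond : ∀ n k : ℕ, stirling2 n k = Nat.stirlingSecond n k
  | 0, 0 => rfl
  | 0, _ + 1 => rfl
  | _ + 1, 0 => rfl
  | n + 1, k + 1 => by
    rw [stirling2, Nat.stirlingSecond_succ_succ, stirling2_eq_stirlingSecond,
      stirling2_eq_stirlingSecond]

theorem Nat.pow_eq_sum_stirlingSecond_mul_descFactorial (n l : ℕ) :
    n ^ l = ∑ k ∈ Finset.range (l + 1), Nat.stirlingSecond l k * n.descFactorial k := by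
  induction l with
  | zero => simp
  | succ l ih =>
    have hterm (k : ℕ) :
        n * n.descFactorial k = n.descFactorial (k + 1) + k * n.descFactorial k := by
      rcases le_or_gt k n with h | h
      · rw [Nat.descFactorial_succ, ← add_mul, Nat.sub_add_cancel h]
      · simp [Nat.descFactorial_of_lt h]
    have hshift : ∑ k ∈ Finset.range (l + 1), Nat.stirlingSecond l k * (k * n.descFactorial k) =
        ∑ k ∈ Finset.range (l + 1),
          Nat.stirlingSecond l (k + 1) * ((k + 1) * n.descFactorial (k + 1)) := by
      rw [Finset.sum_range_succ', Finset.sum_range_succ _ l,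
        Nat.stirlingSecond_eq_zero_of_lt (Nat.lt_succ_self l)]
      simp
    rw [Finset.sum_range_succ', Nat.stirlingSecond_succ_zero, zero_mul, add_zero, pow_succ', ih,
      Finset.mul_sum]
    simp only [Nat.mul_left_comm n, hterm, mul_add, Finset.sum_add_distrib]
    rw [hshift, ← Finset.sum_add_distrib]
    refine Finset.sum_congr rfl fun k _ => ?_
    rw [Nat.stirlingSecond_succ_succ]
    ring

theorem sub_pow_eq_sum_stirling2 (n p : ℕ) (a : ℝ) :
    ((n : ℝ) - a) ^ p = ∑ l ∈ Finset.range (p + 1), ∑ k ∈ Finset.range (l + 1),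
      (p.choose l : ℝ) * (stirling2 l k : ℝ) * (-a) ^ (p - l) * (n.descFactorial k : ℝ) := by
  rw [sub_eq_add_neg, add_pow]
  refine Finset.sum_congr rfl fun l _ => ?_
  have h : (n : ℝ) ^ l =
      ∑ k ∈ Finset.range (l + 1), (stirling2 l k : ℝ) * (n.descFactorial k : ℝ) := by
    simp only [stirling2_eq_stirlingSecond]
    exact_mod_cast Nat.pow_eq_sum_stirlingSecond_mul_descFactorial n l
  rw [h, Finset.sum_mul, Finset.sum_mul]
  refine Finset.sum_congr rfl fun k _ => ?_
  ring

theorem tsum_negMultinomialPMF_mul_apply {d : ℕ} {r : ℝ} (hr : 0 < r)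
    {x : Fin d → ℝ} (hx : ∀ i, 0 ≤ x i) (hx1 : ∑ i, x i < 1) (i : Fin d) :
    ∑' η : Fin d → ℕ, negMultinomialPMF d r x η * (η i : ℝ) = r * (x i / (1 - ∑ j, x j)) := by
  have h := (hasSum_negMultinomialPMF_mul_prod_descFactorial hr hx hx1 (Pi.single i 1)).tsum_eq
  have hdesc (η : Fin d → ℕ) :
      ∏ j, ((η j).descFactorial ((Pi.single i 1 : Fin d → ℕ) j) : ℝ) = η i := by
    rw [Finset.prod_eq_single i (fun j _ hj => by simp [hj]) (by simp)]
    simp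
  have hpow : ∏ j, (x j / (1 - ∑ j, x j)) ^ ((Pi.single i 1 : Fin d → ℕ) j) =
      x i / (1 - ∑ j, x j) := by
    rw [Finset.prod_eq_single i (fun j _ hj => by simp [hj]) (by simp)]
    simp
  simp only [hdesc, hpow] at h
  simpa using h

theorem negMultinomial_centralMoments (d : ℕ) (r : ℝ) (hr : 0 < r) (x : Fin d → ℝ)
    (hx : ∀ i, x i ∈ Set.Icc (0 : ℝ) 1) (hx1 : ∑ i, x i < 1)
    (y : Fin d → ℝ) (hy : ∀ i, y i = x i / (1 - ∑ j, x j))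
    (m : Fin d → ℝ)
    (hm : ∀ i, m i = ∑' η : Fin d → ℕ, negMultinomialPMF d r x η * (η i : ℝ))
    (p : Fin d → ℕ) :
    (∑' η : Fin d → ℕ, negMultinomialPMF d r x η * (∏ i, ((η i : ℝ) - m i) ^ (p i)))
      = ∑ l ∈ Fintype.piFinset (fun i => Finset.range (p i + 1)),
          ∑ k ∈ Fintype.piFinset (fun i => Finset.range (l i + 1)),
            fallingFactorial (r - 1 + ∑ i, (k i : ℝ)) (∑ i, k i) *
              (-r) ^ (∑ i, (p i - l i)) *
              ∏ i, ((p i).choose (l i) : ℝ) * (stirling2 (l i) (k i) : ℝ) *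
                (y i) ^ (p i - l i + k i) := by
  have hx0 (i : Fin d) : 0 ≤ x i := (hx i).1
  have hmean (i : Fin d) : m i = r * y i := by
    rw [hm, hy, tsum_negMultinomialPMF_mul_apply hr hx0 hx1]
  have hexpand (η : Fin d → ℕ) :
      negMultinomialPMF d r x η * (∏ i, ((η i : ℝ) - m i) ^ (p i)) =
        ∑ l ∈ Fintype.piFinset (fun i => Finset.range (p i + 1)),
          ∑ k ∈ Fintype.piFinset (fun i => Finset.range (l i + 1)),
            (∏ i, ((p i).choose (l i) : ℝ) * (stirling2 (l i) (k i) : ℝ) *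
              (-m i) ^ (p i - l i)) *
            (negMultinomialPMF d r x η * ∏ i, ((η i).descFactorial (k i) : ℝ)) := by
    simp only [sub_pow_eq_sum_stirling2, Finset.prod_univ_sum, Finset.mul_sum]
    refine Finset.sum_congr rfl fun l _ => Finset.sum_congr rfl fun k _ => ?_
    rw [Finset.prod_mul_distrib]
    ring
  simp only [hexpand]
  rw [(hasSum_sum fun l _ => hasSum_sum fun k _ =>
    (hasSum_negMultinomialPMF_mul_prod_descFactorial hr hx0 hx1 k).mul_left _).tsum_eq]
  refine Finset.sum_congr rfl fun l _ => Finset.sum_congr rfl fun k _ => ?_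
  rw [← Nat.cast_sum, fallingFactorial_eq_ascPochhammer]
  simp only [← hy, hmean, neg_mul_eq_neg_mul, mul_pow, pow_add, Finset.prod_mul_distrib,
    Finset.prod_pow_eq_pow_sum]
  ring
end
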